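/- arXiv:1901.00356 — 2 statements merged into one kernel-verified Lean document; each statement's English description precedes it below -/
import Mathlib

section
/- For every fixed r > 0 and every y > 0, θ₄(i r y^{−1}) · θ₄(i r y) ≤ θ₄(i r)², with equality if and only if y = 1. That is, the function y ↦ θ₄(i r y^{−1}) θ₄(i r y) on (0,∞) attains its maximum exactly at y = 1. -/
noncomputable section

/-- The Jacobi theta-null `θ₄(iy) = Σ_{k∈ℤ} (-1)^k e^{-π k² y}` for `y > 0`. -/
def theta4 (y : ℝ) : ℝ := ∑' k : ℤ, (-1 : ℝ) ^ k * Real.exp (-Real.pi * (k : ℝ) ^ 2 * y)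

open Filter Topology Finset

/-- The Gaussian binomial coefficients, defined by the `q`-Pascal recursion. -/
def gaussBinom (x : ℝ) : ℕ → ℕ → ℝ
  | _, 0 => 1
  | 0, _ + 1 => 0
  | n + 1, k + 1 => gaussBinom x n k + x ^ (k + 1) * gaussBinom x n (k + 1)

theorem gaussBinom_zero_right (x : ℝ) (n : ℕ) : gaussBinom x n 0 = 1 := by
  cases n <;> rfl

theorem gaussBinom_eq_zero_of_lt (x : ℝ) {n k : ℕ} (h : n < k) : gaussBinom x n k = 0 := by
  induction n generalizing k with
  | zero => obtain ⟨k, rfl⟩ := Nat.exists_eq_succ_of_ne_zero h.ne'; rfl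
  | succ n ih =>
    obtain ⟨k, rfl⟩ := Nat.exists_eq_succ_of_ne_zero (Nat.ne_zero_of_lt h)
    rw [Nat.succ_eq_add_one, gaussBinom, ih (by omega), ih (by omega)]
    ring

theorem gaussBinom_self (x : ℝ) (n : ℕ) : gaussBinom x n n = 1 := by
  induction n with
  | zero => rfl
  | succ n ih => rw [gaussBinom, ih, gaussBinom_eq_zero_of_lt x n.lt_succ_self]; ring

/-- The finite `q`-Pochhammer symbol `(x; x)_n`. -/
def qPochhammer (x : ℝ) (n : ℕ) : ℝ := ∏ i ∈ range n, (1 - x ^ (i + 1))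

theorem qPochhammer_succ (x : ℝ) (n : ℕ) :
    qPochhammer x (n + 1) = qPochhammer x n * (1 - x ^ (n + 1)) :=
  prod_range_succ _ _

theorem gaussBinom_add_mul (x : ℝ) (i j : ℕ) :
    gaussBinom x (i + j) i * (qPochhammer x i * qPochhammer x j) = qPochhammer x (i + j) := by
  induction i generalizing j with
  | zero => simp [gaussBinom_zero_right, qPochhammer]
  | succ i ihi =>
    induction j with
    | zero => simp [gaussBinom_self, qPochhammer]
    | succ j ihj =>
      have h1 := ihi (j + 1)
      rw [show i + (j + 1) = i + 1 + j by ring] at h1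
      rw [show i + 1 + (j + 1) = (i + 1 + j) + 1 by ring, gaussBinom,
        qPochhammer_succ x (i + 1 + j)]
      rw [qPochhammer_succ x j] at h1 ⊢
      rw [qPochhammer_succ x i] at ihj ⊢
      linear_combination (1 - x ^ (i + 1)) * h1 + x ^ (i + 1) * (1 - x ^ (j + 1)) * ihj

/-- Rothe's `q`-binomial theorem. -/
theorem prod_one_add_mul_pow_eq_sum_gaussBinom (x a : ℝ) (n : ℕ) :
    ∏ j ∈ range n, (1 + a * x ^ j) =
      ∑ k ∈ range (n + 1), x ^ k.choose 2 * gaussBinom x n k * a ^ k := by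
  induction n generalizing a with
  | zero => simp [gaussBinom_zero_right]
  | succ n ih =>
    have h : ∏ j ∈ range n, (1 + a * x ^ (j + 1)) =
        ∑ k ∈ range (n + 1), x ^ k.choose 2 * gaussBinom x n k * (a * x) ^ k := by
      rw [← ih]
      exact prod_congr rfl fun j _ => by ring
    have h' : ∑ k ∈ range (n + 1), x ^ k.choose 2 * gaussBinom x n k * (a * x) ^ k =
        1 + ∑ k ∈ range (n + 1),
          x ^ (k + 1).choose 2 * gaussBinom x n (k + 1) * (a * x) ^ (k + 1) := by
      rw [sum_range_succ', sum_range_succ (fun k =>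
        x ^ (k + 1).choose 2 * gaussBinom x n (k + 1) * (a * x) ^ (k + 1)),
        gaussBinom_eq_zero_of_lt x n.lt_succ_self]
      simp [gaussBinom_zero_right, add_comm]
    rw [prod_range_succ', h, sum_range_succ' _ (n + 1), pow_zero, mul_one, mul_add, mul_one]
    nth_rw 1 [h']
    rw [sum_mul, add_assoc, ← sum_add_distrib, add_comm]
    congr 1
    · refine sum_congr rfl fun k _ => ?_
      rw [gaussBinom, Nat.choose_succ_succ' k 1, Nat.choose_one_right]
      ring
    · simp [gaussBinom_zero_right]

theorem prod_one_sub_odd_pow_symm {q : ℝ} (hq : q ≠ 0) (N : ℕ) :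
    ∏ j ∈ range (2 * N), (1 + -(q ^ (1 - 2 * N : ℤ)) * (q ^ 2) ^ j) =
      (-1) ^ N * q ^ (-(N : ℤ) ^ 2) * (∏ i ∈ range N, (1 - q ^ (2 * i + 1))) ^ 2 := by
  have h1 : ∏ j ∈ range N, (1 + -(q ^ (1 - 2 * N : ℤ)) * (q ^ 2) ^ (N + j)) =
      ∏ i ∈ range N, (1 - q ^ (2 * i + 1)) := by
    refine prod_congr rfl fun j _ => ?_
    rw [← pow_mul, ← zpow_natCast, ← zpow_natCast q (2 * j + 1), neg_mul, ← zpow_add₀ hq,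
      ← sub_eq_add_neg]
    congr 2
    push_cast
    ring
  have h2 : ∏ j ∈ range N, (1 + -(q ^ (1 - 2 * N : ℤ)) * (q ^ 2) ^ j) =
      (-1) ^ N * q ^ (-(N : ℤ) ^ 2) * ∏ i ∈ range N, (1 - q ^ (2 * i + 1)) := by
    rw [← prod_range_reflect]
    have h3 : (-1) ^ N * q ^ (-(N : ℤ) ^ 2) = ∏ i ∈ range N, -q ^ (-(2 * i + 1) : ℤ) := by
      clear h1
      induction N with
      | zero => simp
      | succ N ih =>
        rw [prod_range_succ, ← ih, show (-((N + 1 : ℕ) : ℤ) ^ 2) =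
          -(N : ℤ) ^ 2 + (-(2 * N + 1) : ℤ) by push_cast; ring, zpow_add₀ hq]
        ring
    rw [h3, ← prod_mul_distrib]
    refine prod_congr rfl fun j hj => ?_
    have hj' : j + 1 ≤ N := mem_range.1 hj
    have e : ((2 * (N - 1 - j) : ℕ) : ℤ) = 2 * N - 2 - 2 * j := by omega
    rw [← pow_mul, ← zpow_natCast q (2 * (N - 1 - j)), neg_mul, ← zpow_add₀ hq, e,
      ← zpow_natCast q (2 * j + 1), mul_sub, neg_mul, neg_mul, ← zpow_add₀ hq]
    rw [show (1 - 2 * (N : ℤ) + (2 * N - 2 - 2 * j)) = -(2 * j + 1) by ring,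
      show (-(2 * (j : ℤ) + 1) + ((2 * j + 1 : ℕ) : ℤ)) = 0 by push_cast; ring]
    simp only [zpow_zero]
    ring
  rw [two_mul, prod_range_add, h1, h2]
  ring

/-- The finite form of the Jacobi triple product, at `z = -1`. -/
theorem sum_gaussBinom_eq_prod_sq {q : ℝ} (hq : q ≠ 0) (N : ℕ) :
    ∑ m ∈ Icc (-N : ℤ) N, (-1) ^ m * q ^ (m ^ 2) * gaussBinom (q ^ 2) (2 * N) (N + m).toNat =
      (∏ i ∈ range N, (1 - q ^ (2 * i + 1))) ^ 2 := by
  have h := prod_one_sub_odd_pow_symm hq N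
  rw [prod_one_add_mul_pow_eq_sum_gaussBinom] at h
  have hs : ((-1 : ℝ) ^ N) * (-1) ^ N = 1 := by rw [← mul_pow]; simp
  have hz : q ^ ((N : ℤ) ^ 2) * q ^ (-(N : ℤ) ^ 2) = 1 := by rw [← zpow_add₀ hq]; simp
  have h' : (∏ i ∈ range N, (1 - q ^ (2 * i + 1))) ^ 2 = (-1) ^ N * q ^ ((N : ℤ) ^ 2) *
      ∑ k ∈ range (2 * N + 1), (q ^ 2) ^ k.choose 2 * gaussBinom (q ^ 2) (2 * N) k *
        (-(q ^ (1 - 2 * N : ℤ))) ^ k := by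
    rw [h]
    linear_combination (-(∏ i ∈ range N, (1 - q ^ (2 * i + 1))) ^ 2) *
      (hs * (q ^ ((N : ℤ) ^ 2) * q ^ (-(N : ℤ) ^ 2)) + hz)
  rw [h', mul_sum]
  symm
  refine sum_bij' (fun k _ => (k : ℤ) - N) (fun m _ => (N + m).toNat) ?_ ?_ ?_ ?_ ?_
  · intro k hk; simp at hk ⊢; omega
  · intro k hk; simp at hk ⊢; omega
  · intro k hk; simp
  · intro k hk; simp at hk ⊢; omega
  · intro k _
    have e1 : ((N : ℤ) + ((k : ℤ) - N)).toNat = k := by simp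
    have e2 : (q ^ 2) ^ k.choose 2 = q ^ ((k : ℤ) * (k - 1)) := by
      rw [← pow_mul, ← zpow_natCast]
      congr 1
      have : 2 * k.choose 2 = k * (k - 1) := by
        rw [Nat.choose_two_right]; exact Nat.mul_div_cancel' (Nat.even_mul_pred_self k).two_dvd
      rw [this]
      cases k <;> simp
    have e3 : (-(q ^ (1 - 2 * N : ℤ))) ^ k = (-1) ^ k * q ^ ((1 - 2 * N : ℤ) * k) := by
      rw [neg_pow, zpow_mul, zpow_natCast]
    have e4 : (-1 : ℝ) ^ ((k : ℤ) - N) = (-1) ^ N * (-1) ^ k := by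
      rw [zpow_sub₀ (by norm_num), zpow_natCast, zpow_natCast, div_eq_iff (by simp)]
      linear_combination (-(-1 : ℝ) ^ k) * hs
    have e5 : q ^ (((k : ℤ) - N) ^ 2) =
        q ^ ((N : ℤ) ^ 2) * q ^ ((k : ℤ) * (k - 1)) * q ^ ((1 - 2 * N : ℤ) * k) := by
      rw [← zpow_add₀ hq, ← zpow_add₀ hq]; congr 1; ring
    rw [e1, e2, e3, e4, e5]
    ring

section Limits

variable {x : ℝ}

theorem qPochhammer_pos (hx0 : 0 < x) (hx1 : x < 1) (n : ℕ) : 0 < qPochhammer x n :=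
  prod_pos fun i _ => sub_pos.2 (pow_lt_one₀ hx0.le hx1 i.succ_ne_zero)

theorem qPochhammer_antitone (hx0 : 0 < x) (hx1 : x < 1) : Antitone (qPochhammer x) := by
  refine antitone_nat_of_succ_le fun n => ?_
  rw [qPochhammer_succ]
  exact mul_le_of_le_one_right (qPochhammer_pos hx0 hx1 n).le
    (by have := pow_pos hx0 (n + 1); linarith)

theorem exists_pos_tendsto_prod_one_sub {u : ℕ → ℝ} (hu : Summable u) (hu1 : ∀ n, u n < 1) :
    ∃ P, 0 < P ∧ Tendsto (fun n => ∏ i ∈ range n, (1 - u i)) atTop (𝓝 P) := by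
  have hlog : Summable fun i => Real.log (1 - u i) := by
    simpa [sub_eq_add_neg] using Real.summable_log_one_add_of_summable hu.neg
  have hpos : ∀ i, 0 < 1 - u i := fun i => sub_pos.2 (hu1 i)
  exact ⟨_, Real.exp_pos _, (Real.hasProd_of_hasSum_log hpos hlog.hasSum).tendsto_prod_nat⟩

theorem exists_pos_tendsto_qPochhammer (hx0 : 0 < x) (hx1 : x < 1) :
    ∃ P, 0 < P ∧ Tendsto (qPochhammer x) atTop (𝓝 P) :=
  exists_pos_tendsto_prod_one_sub
    ((summable_nat_add_iff 1).2 (summable_geometric_of_lt_one hx0.le hx1))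
    fun n => pow_lt_one₀ hx0.le hx1 n.succ_ne_zero

theorem exists_pos_tendsto_prod_one_sub_odd_pow {q : ℝ} (hq0 : 0 < q) (hq1 : q < 1) :
    ∃ D, 0 < D ∧ Tendsto (fun n => ∏ i ∈ range n, (1 - q ^ (2 * i + 1))) atTop (𝓝 D) :=
  exists_pos_tendsto_prod_one_sub
    ((summable_geometric_of_lt_one hq0.le hq1).comp_injective
      (i := fun n : ℕ => 2 * n + 1) fun a b h => by simpa using h)
    fun n => pow_lt_one₀ hq0.le hq1 (Nat.succ_ne_zero _)

theorem gaussBinom_eq_div (hx0 : 0 < x) (hx1 : x < 1) {m : ℤ} {N : ℕ}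
    (hm : m ∈ Icc (-N : ℤ) N) :
    gaussBinom x (2 * N) (N + m).toNat = qPochhammer x (2 * N) /
      (qPochhammer x (N + m).toNat * qPochhammer x (N - m).toNat) := by
  have h := gaussBinom_add_mul x (N + m).toNat (N - m).toNat
  rw [mem_Icc] at hm
  rw [show (N + m).toNat + (N - m).toNat = 2 * N by omega] at h
  rw [← h, mul_div_cancel_right₀]
  exact (mul_pos (qPochhammer_pos hx0 hx1 _) (qPochhammer_pos hx0 hx1 _)).ne'

theorem tendsto_toNat_add (m : ℤ) : Tendsto (fun N : ℕ => ((N : ℤ) + m).toNat) atTop atTop := by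
  refine tendsto_atTop.2 fun b => ?_
  filter_upwards [eventually_ge_atTop (b + m.natAbs)] with N hN
  omega

/-- Gauss's product formula for `∑ (-1)^m q^(m²)`, as a limit of partial products. -/
theorem tendsto_prod_tsum_alternating {q : ℝ} (hq0 : 0 < q) (hq1 : q < 1)
    (hs : Summable fun m : ℤ => q ^ (m ^ 2)) :
    Tendsto (fun N => qPochhammer (q ^ 2) N * (∏ i ∈ range N, (1 - q ^ (2 * i + 1))) ^ 2) atTop
      (𝓝 (∑' m : ℤ, (-1) ^ m * q ^ (m ^ 2))) := by
  have hx0 : 0 < q ^ 2 := by positivity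
  have hx1 : q ^ 2 < 1 := pow_lt_one₀ hq0.le hq1 two_ne_zero
  obtain ⟨P, hP, hlim⟩ := exists_pos_tendsto_qPochhammer hx0 hx1
  have hle : ∀ n, P ≤ qPochhammer (q ^ 2) n := (qPochhammer_antitone hx0 hx1).le_of_tendsto hlim
  have hpos := qPochhammer_pos hx0 hx1
  let f : ℕ → ℤ → ℝ := fun N m => if m ∈ Icc (-N : ℤ) N then
    (-1) ^ m * q ^ (m ^ 2) * gaussBinom (q ^ 2) (2 * N) (N + m).toNat else 0
  have key : Tendsto (fun N => ∑' m, f N m) atTop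
      (𝓝 (∑' m : ℤ, (-1) ^ m * q ^ (m ^ 2) * P⁻¹)) := by
    refine tendsto_tsum_of_dominated_convergence (hs.mul_right P⁻¹) (fun m => ?_)
      (Eventually.of_forall fun N m => ?_)
    · have hl : Tendsto (fun N : ℕ => (-1 : ℝ) ^ m * q ^ (m ^ 2) * (qPochhammer (q ^ 2) (2 * N) /
          (qPochhammer (q ^ 2) (N + m).toNat * qPochhammer (q ^ 2) (N - m).toNat))) atTop
          (𝓝 ((-1) ^ m * q ^ (m ^ 2) * (P / (P * P)))) := by
        refine Tendsto.const_mul _ (Tendsto.div ?_ (Tendsto.mul ?_ ?_) (by positivity))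
        · exact hlim.comp (tendsto_id.const_mul_atTop' two_pos)
        · exact hlim.comp (tendsto_toNat_add m)
        · simpa only [sub_eq_add_neg] using! hlim.comp (tendsto_toNat_add (-m))
      rw [show P⁻¹ = P / (P * P) by field_simp]
      refine hl.congr' ?_
      filter_upwards [eventually_ge_atTop m.natAbs] with N hN
      have hm : m ∈ Icc (-N : ℤ) N := by rw [mem_Icc]; omega
      simp only [f, if_pos hm, gaussBinom_eq_div hx0 hx1 hm]
    · by_cases hm : m ∈ Icc (-N : ℤ) N
      · have hqm : 0 < q ^ (m ^ 2) := zpow_pos hq0 _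
        simp only [f, if_pos hm, gaussBinom_eq_div hx0 hx1 hm]
        rw [norm_mul, norm_mul, norm_zpow, norm_neg, norm_one, one_zpow, one_mul,
          Real.norm_of_nonneg hqm.le, Real.norm_of_nonneg
            (div_pos (hpos _) (mul_pos (hpos _) (hpos _))).le]
        refine mul_le_mul_of_nonneg_left ?_ hqm.le
        rw [div_le_iff₀ (mul_pos (hpos _) (hpos _)), inv_mul_eq_div, le_div_iff₀ hP]
        refine mul_le_mul (qPochhammer_antitone hx0 hx1 ?_) (hle _) hP.le (hpos _).le
        rw [mem_Icc] at hm
        omega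
      · simp only [f, if_neg hm, norm_zero]
        exact mul_nonneg (zpow_nonneg hq0.le _) (inv_nonneg.2 hP.le)
  have hf : ∀ N, ∑' m, f N m = (∏ i ∈ range N, (1 - q ^ (2 * i + 1))) ^ 2 := fun N => by
    rw [tsum_eq_sum (s := Icc (-N : ℤ) N) fun m hm => if_neg hm,
      ← sum_gaussBinom_eq_prod_sq hq0.ne']
    exact sum_congr rfl fun m hm => if_pos hm
  simp only [hf] at key
  have := hlim.mul key
  rwa [tsum_mul_right, mul_comm (tsum _), mul_inv_cancel_left₀ hP.ne'] at this

end Limits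

/-- The factors in the product expansion of `theta4`. -/
def theta4Factor (i : ℕ) (y : ℝ) : ℝ :=
  (1 - Real.exp (-(2 * (i + 1) * Real.pi * y))) *
    (1 - Real.exp (-((2 * i + 1) * Real.pi * y))) ^ 2

theorem prod_theta4Factor (y : ℝ) (N : ℕ) :
    ∏ i ∈ range N, theta4Factor i y = qPochhammer (Real.exp (-(Real.pi * y)) ^ 2) N *
      (∏ i ∈ range N, (1 - Real.exp (-(Real.pi * y)) ^ (2 * i + 1))) ^ 2 := by
  rw [qPochhammer, ← prod_pow, ← prod_mul_distrib]
  refine prod_congr rfl fun i _ => ?_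
  rw [theta4Factor, ← pow_mul, ← Real.exp_nat_mul, ← Real.exp_nat_mul]
  push_cast
  ring_nf

theorem exp_zpow_sq (y : ℝ) (m : ℤ) :
    Real.exp (-(Real.pi * y)) ^ (m ^ 2) = Real.exp (-Real.pi * (m : ℝ) ^ 2 * y) := by
  rw [← Real.rpow_intCast, ← Real.exp_mul]
  push_cast
  ring_nf

theorem summable_exp_zpow_sq {y : ℝ} (hy : 0 < y) :
    Summable fun m : ℤ => Real.exp (-(Real.pi * y)) ^ (m ^ 2) := by
  refine (HurwitzKernelBounds.summable_f_int 0 0 hy).congr fun m => ?_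
  rw [exp_zpow_sq, HurwitzKernelBounds.f_int, pow_zero, one_mul, add_zero]

theorem theta4_eq_tsum_zpow (y : ℝ) :
    theta4 y = ∑' m : ℤ, (-1) ^ m * Real.exp (-(Real.pi * y)) ^ (m ^ 2) := by
  refine tsum_congr fun m => ?_
  rw [exp_zpow_sq]

theorem tendsto_prod_theta4Factor {y : ℝ} (hy : 0 < y) :
    Tendsto (fun N => ∏ i ∈ range N, theta4Factor i y) atTop (𝓝 (theta4 y)) := by
  simp only [prod_theta4Factor]
  rw [theta4_eq_tsum_zpow]
  exact tendsto_prod_tsum_alternating (Real.exp_pos _)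
    (Real.exp_lt_one_iff.2 (neg_lt_zero.2 (by positivity))) (summable_exp_zpow_sq hy)

theorem theta4_pos {y : ℝ} (hy : 0 < y) : 0 < theta4 y := by
  have hq0 := Real.exp_pos (-(Real.pi * y))
  have hq1 : Real.exp (-(Real.pi * y)) < 1 := Real.exp_lt_one_iff.2 (neg_lt_zero.2 (by positivity))
  obtain ⟨P, hP, hPl⟩ := exists_pos_tendsto_qPochhammer (pow_pos hq0 2)
    (pow_lt_one₀ hq0.le hq1 two_ne_zero)
  obtain ⟨D, hD, hDl⟩ := exists_pos_tendsto_prod_one_sub_odd_pow hq0 hq1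
  have h := tendsto_prod_theta4Factor hy
  simp only [prod_theta4Factor] at h
  rw [tendsto_nhds_unique h (hPl.mul (hDl.pow 2))]
  positivity

theorem strictAntiOn_div_exp_sub_one :
    StrictAntiOn (fun x : ℝ => x / (Real.exp x - 1)) (Set.Ioi 0) := by
  intro a (ha : 0 < a) b (hb : 0 < b) hab
  have h := strictConvexOn_exp.secant_strict_mono (a := 0) (Set.mem_univ _) (Set.mem_univ a)
    (Set.mem_univ b) ha.ne' hb.ne' hab
  simp only [Real.exp_zero, sub_zero] at h
  have hea : 0 < Real.exp a - 1 := sub_pos.2 (Real.one_lt_exp_iff.2 ha)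
  simpa only [inv_div] using inv_strictAnti₀ (div_pos hea ha) h

theorem hasDerivAt_log_one_sub_exp_neg_exp (u : ℝ) :
    HasDerivAt (fun u => Real.log (1 - Real.exp (-Real.exp u)))
      (Real.exp u / (Real.exp (Real.exp u) - 1)) u := by
  have hlt : Real.exp (-Real.exp u) < 1 := Real.exp_lt_one_iff.2 (neg_lt_zero.2 (Real.exp_pos u))
  have h := (((Real.hasDerivAt_exp u).fun_neg.exp).const_sub 1).log (sub_pos.2 hlt).ne'
  convert h using 1
  have h1 : 0 < Real.exp (Real.exp u) - 1 := sub_pos.2 (Real.one_lt_exp_iff.2 (Real.exp_pos u))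
  rw [div_eq_div_iff h1.ne' (sub_pos.2 hlt).ne', Real.exp_neg]
  field_simp

theorem strictConcaveOn_log_one_sub_exp_neg_exp :
    StrictConcaveOn ℝ Set.univ fun u => Real.log (1 - Real.exp (-Real.exp u)) := by
  refine StrictAnti.strictConcaveOn_univ_of_deriv
    (continuous_iff_continuousAt.2 fun u => (hasDerivAt_log_one_sub_exp_neg_exp u).continuousAt) ?_
  rw [show deriv (fun u => Real.log (1 - Real.exp (-Real.exp u))) =
    fun u => Real.exp u / (Real.exp (Real.exp u) - 1) from
      funext fun u => (hasDerivAt_log_one_sub_exp_neg_exp u).deriv]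
  exact fun a b hab => strictAntiOn_div_exp_sub_one (Real.exp_pos a) (Real.exp_pos b)
    (Real.exp_lt_exp.2 hab)

theorem one_sub_exp_neg_pos {a : ℝ} (ha : 0 < a) : 0 < 1 - Real.exp (-a) :=
  sub_pos.2 (Real.exp_lt_one_iff.2 (neg_lt_zero.2 ha))

theorem one_sub_exp_neg_mul_lt {a y : ℝ} (ha : 0 < a) (hy : 0 < y) (hy1 : y ≠ 1) :
    (1 - Real.exp (-(a * y⁻¹))) * (1 - Real.exp (-(a * y))) < (1 - Real.exp (-a)) ^ 2 := by
  have hne : Real.log a - Real.log y ≠ Real.log a + Real.log y := fun h =>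
    Real.log_ne_zero_of_pos_of_ne_one hy hy1 (by linarith)
  have h := strictConcaveOn_log_one_sub_exp_neg_exp.2 (Set.mem_univ _) (Set.mem_univ _) hne
    one_half_pos one_half_pos (add_halves 1)
  simp only [smul_eq_mul] at h
  rw [show 1 / 2 * (Real.log a - Real.log y) + 1 / 2 * (Real.log a + Real.log y) = Real.log a by
    ring, Real.exp_sub, Real.exp_add, Real.exp_log ha, Real.exp_log hy, div_eq_mul_inv a y] at h
  have h1 := one_sub_exp_neg_pos (mul_pos ha (inv_pos.2 hy))
  have h2 := one_sub_exp_neg_pos (mul_pos ha hy)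
  have h3 := one_sub_exp_neg_pos ha
  rw [← Real.log_lt_log_iff (mul_pos h1 h2) (pow_pos h3 2), Real.log_mul h1.ne' h2.ne',
    Real.log_pow]
  push_cast
  linarith

theorem theta4Factor_pos (i : ℕ) {y : ℝ} (hy : 0 < y) : 0 < theta4Factor i y :=
  mul_pos (one_sub_exp_neg_pos (by positivity)) (pow_pos (one_sub_exp_neg_pos (by positivity)) 2)

theorem theta4Factor_mul_lt (i : ℕ) {r y : ℝ} (hr : 0 < r) (hy : 0 < y) (hy1 : y ≠ 1) :
    theta4Factor i (r * y⁻¹) * theta4Factor i (r * y) < theta4Factor i r ^ 2 := by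
  have h1 := one_sub_exp_neg_mul_lt (a := 2 * (i + 1) * Real.pi * r) (by positivity) hy hy1
  have h2 := one_sub_exp_neg_mul_lt (a := (2 * i + 1) * Real.pi * r) (by positivity) hy hy1
  have p1 := one_sub_exp_neg_pos (a := (2 * i + 1) * Real.pi * r * y⁻¹) (by positivity)
  have p2 := one_sub_exp_neg_pos (a := (2 * i + 1) * Real.pi * r * y) (by positivity)
  have p3 := one_sub_exp_neg_pos (a := 2 * (i + 1) * Real.pi * r) (by positivity)
  have h := mul_lt_mul'' h1 (pow_lt_pow_left₀ h2 (mul_pos p1 p2).le two_ne_zero)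
    (mul_pos (one_sub_exp_neg_pos (by positivity)) (one_sub_exp_neg_pos (by positivity))).le
    (sq_nonneg _)
  simp only [theta4Factor, ← mul_assoc _ r]
  calc _ = _ := by ring
    _ < _ := h
    _ = _ := by ring

theorem theta4_mul_lt {r y : ℝ} (hr : 0 < r) (hy : 0 < y) (hy1 : y ≠ 1) :
    theta4 (r * y⁻¹) * theta4 (r * y) < theta4 r ^ 2 := by
  have ha : 0 < r * y⁻¹ := by positivity
  have hb : 0 < r * y := by positivity
  set c := theta4Factor 0 (r * y⁻¹) * theta4Factor 0 (r * y) with hc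
  have hc0 : 0 < c := mul_pos (theta4Factor_pos 0 ha) (theta4Factor_pos 0 hb)
  have hd : 0 < theta4Factor 0 r ^ 2 := pow_pos (theta4Factor_pos 0 hr) 2
  have hle : theta4 (r * y⁻¹) * theta4 (r * y) ≤
      c / theta4Factor 0 r ^ 2 * theta4 r ^ 2 := by
    refine le_of_tendsto_of_tendsto'
      (((tendsto_prod_theta4Factor ha).mul (tendsto_prod_theta4Factor hb)).comp
        (tendsto_add_atTop_nat 1))
      ((((tendsto_prod_theta4Factor hr).pow 2).const_mul _).comp (tendsto_add_atTop_nat 1))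
      fun N => ?_
    simp only [Function.comp_apply, prod_range_succ']
    have hN : ∏ i ∈ range N, theta4Factor (i + 1) (r * y⁻¹) * theta4Factor (i + 1) (r * y) ≤
        ∏ i ∈ range N, theta4Factor (i + 1) r ^ 2 :=
      prod_le_prod (fun i _ => (mul_pos (theta4Factor_pos _ ha) (theta4Factor_pos _ hb)).le)
        fun i _ => (theta4Factor_mul_lt _ hr hy hy1).le
    rw [prod_mul_distrib, prod_pow] at hN
    calc _ = c * _ := by rw [hc]; ring
      _ ≤ c * _ := mul_le_mul_of_nonneg_left hN hc0.le
      _ = _ := by rw [mul_pow, mul_comm _ (theta4Factor 0 r ^ 2), ← mul_assoc,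
        div_mul_cancel₀ _ hd.ne']
  refine hle.trans_lt (mul_lt_of_lt_one_left (pow_pos (theta4_pos hr) 2) ?_)
  exact (div_lt_one hd).2 (theta4Factor_mul_lt 0 hr hy hy1)

/-- for every `r > 0` the function `y ↦ θ₄(iry⁻¹)θ₄(iry)` on `(0,∞)`
attains its maximum `θ₄(ir)²` exactly at `y = 1`. -/
theorem theta4_product_max (r : ℝ) (hr : 0 < r) (y : ℝ) (hy : 0 < y) :
    theta4 (r * y⁻¹) * theta4 (r * y) ≤ theta4 r ^ 2 ∧
    (theta4 (r * y⁻¹) * theta4 (r * y) = theta4 r ^ 2 ↔ y = 1) := by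
  rcases eq_or_ne y 1 with rfl | hy1
  · simp [sq]
  · have h := theta4_mul_lt hr hy hy1
    exact ⟨h.le, fun e => absurd e h.ne, fun e => absurd e hy1⟩

end
end

section
/- For every fixed r > 0 and every y > 0, θ₃(i r y^{−1}) · θ₃(i r y) ≥ θ₃(i r)², with equality if and only if y = 1. That is, the function y ↦ θ₃(i r y^{−1}) θ₃(i r y) on (0,∞) attains its minimum exactly at y = 1. -/
noncomputable section

/-- The Jacobi theta-null `θ₃(iy) = Σ_{k∈ℤ} e^{-π k² y}` for `y > 0`. -/
def theta3 (y : ℝ) : ℝ := ∑' k : ℤ, Real.exp (-Real.pi * (k : ℝ) ^ 2 * y)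

open Real Set

/-- The even moments `Σ_{k∈ℤ} k^{2m} e^{-π k² u}` of the theta series; `m = 0` gives `theta3`. -/
def thetaMoment (m : ℕ) (u : ℝ) : ℝ :=
  ∑' k : ℤ, (k : ℝ) ^ (2 * m) * exp (-π * (k : ℝ) ^ 2 * u)

lemma theta3_eq_thetaMoment (u : ℝ) : theta3 u = thetaMoment 0 u := by
  simp [theta3, thetaMoment]

lemma summable_thetaMoment (m : ℕ) {u : ℝ} (hu : 0 < u) :
    Summable fun k : ℤ ↦ (k : ℝ) ^ (2 * m) * exp (-π * (k : ℝ) ^ 2 * u) := by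
  refine (summable_pow_mul_jacobiTheta₂_term_bound 0 hu (2 * m)).congr fun k ↦ ?_
  rw [Int.cast_abs, (even_two_mul m).pow_abs]
  congr 2
  ring

lemma hasDerivAt_thetaMoment (m : ℕ) {u : ℝ} (hu : 0 < u) :
    HasDerivAt (thetaMoment m) (-π * thetaMoment (m + 1) u) u := by
  have hterm (k : ℤ) (v : ℝ) :
      HasDerivAt (fun v ↦ (k : ℝ) ^ (2 * m) * exp (-π * (k : ℝ) ^ 2 * v))
        (-π * ((k : ℝ) ^ (2 * (m + 1)) * exp (-π * (k : ℝ) ^ 2 * v))) v := by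
    have h := (((hasDerivAt_id v).const_mul (-π * (k : ℝ) ^ 2)).exp).const_mul ((k : ℝ) ^ (2 * m))
    refine h.congr_deriv ?_
    simp only [id]
    ring
  have hsum := (summable_thetaMoment (m + 1) (half_pos hu)).mul_left π
  have h := hasDerivAt_tsum_of_isPreconnected hsum isOpen_Ioi isPreconnected_Ioi
    (fun k v _ ↦ hterm k v) (fun k v (hv : u / 2 < v) ↦ ?_) (half_lt_self hu)
    (summable_thetaMoment m hu) (half_lt_self hu)
  · rw [tsum_mul_left] at h
    exact h
  · have hk : 0 ≤ (k : ℝ) ^ (2 * (m + 1)) := (even_two_mul _).pow_nonneg _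
    rw [norm_mul, norm_neg, norm_of_nonneg pi_pos.le, norm_of_nonneg (by positivity)]
    gcongr π * (_ * exp ?_)
    have : 0 ≤ π * (k : ℝ) ^ 2 := by positivity
    nlinarith

lemma one_le_thetaMoment_zero {u : ℝ} (hu : 0 < u) : 1 ≤ thetaMoment 0 u := by
  simpa [thetaMoment] using
    (summable_thetaMoment 0 hu).le_tsum 0 fun k _ ↦ by simp [exp_nonneg]

lemma thetaMoment_pos (m : ℕ) {u : ℝ} (hu : 0 < u) : 0 < thetaMoment m u :=
  (summable_thetaMoment m hu).tsum_pos
    (fun k ↦ mul_nonneg ((even_two_mul m).pow_nonneg _) (exp_nonneg _)) 1 (by simp [exp_pos])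

lemma thetaMoment_one_le_two {u : ℝ} (hu : 0 < u) : thetaMoment 1 u ≤ thetaMoment 2 u := by
  refine (summable_thetaMoment 1 hu).tsum_le_tsum (fun k ↦ ?_) (summable_thetaMoment 2 hu)
  gcongr ?_ * _
  have : k ^ 2 ≤ (k ^ 2) ^ 2 := Int.le_self_sq _
  have : (k : ℝ) ^ 2 ≤ ((k : ℝ) ^ 2) ^ 2 := by exact_mod_cast this
  calc (k : ℝ) ^ (2 * 1) = (k : ℝ) ^ 2 := by ring
    _ ≤ ((k : ℝ) ^ 2) ^ 2 := this
    _ = (k : ℝ) ^ (2 * 2) := by ring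

lemma thetaMoment_one_lt {u : ℝ} (hu : 1 ≤ u) : thetaMoment 1 u < 2 / 3 := by
  have hz : HasSum (fun k : ℤ ↦ 1 / (k : ℝ) ^ 4) (π ^ 4 / 90 + π ^ 4 / 90 - 1 / ((0 : ℤ) : ℝ) ^ 4) :=
    HasSum.of_nat_of_neg (f := fun k : ℤ ↦ 1 / (k : ℝ) ^ 4)
      (by simpa using hasSum_zeta_four)
      (by simpa [Even.neg_pow (show Even 4 by decide)] using hasSum_zeta_four)
  have hz' := hz.mul_left (6 / π ^ 3)
  have hle : thetaMoment 1 u ≤ 6 / π ^ 3 * (π ^ 4 / 90 + π ^ 4 / 90 - 1 / ((0 : ℤ) : ℝ) ^ 4) := by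
    rw [← hz'.tsum_eq]
    refine (summable_thetaMoment 1 (by linarith)).tsum_le_tsum (fun k ↦ ?_) hz'.summable
    rcases eq_or_ne k 0 with rfl | hk
    · simp
    have hk' : (0 : ℝ) < (k : ℝ) ^ 2 := by positivity
    have hexp := pow_div_factorial_le_exp (π * (k : ℝ) ^ 2) (by positivity) 3
    have hmono : exp (-π * (k : ℝ) ^ 2 * u) ≤ (exp (π * (k : ℝ) ^ 2))⁻¹ := by
      rw [← exp_neg, exp_le_exp]
      nlinarith [mul_pos pi_pos hk']
    calc (k : ℝ) ^ (2 * 1) * exp (-π * (k : ℝ) ^ 2 * u)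
        ≤ (k : ℝ) ^ (2 * 1) * ((π * (k : ℝ) ^ 2) ^ 3 / (Nat.factorial 3 : ℕ))⁻¹ := by
          gcongr
          exact hmono.trans (inv_anti₀ (by positivity) hexp)
      _ = 6 / π ^ 3 * (1 / (k : ℝ) ^ 4) := by
          have : (k : ℝ) ≠ 0 := by exact_mod_cast hk
          simp only [Nat.factorial]
          push_cast
          field_simp
  have heq : 6 / π ^ 3 * (π ^ 4 / 90 + π ^ 4 / 90 - 1 / ((0 : ℤ) : ℝ) ^ 4) = 2 * π / 15 := by
    simp
    field_simp
    norm_num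
  rw [heq] at hle
  linarith [pi_lt_d2]

/-- `-1 / π` times the derivative of `t ↦ log (theta3 (exp t))`, at `u = exp t`. -/
def thetaLogSlope (u : ℝ) : ℝ := u * thetaMoment 1 u / thetaMoment 0 u

lemma strictAntiOn_thetaLogSlope : StrictAntiOn thetaLogSlope (Ici 1) := by
  have hder {u : ℝ} (hu : 0 < u) := ((hasDerivAt_id u).mul (hasDerivAt_thetaMoment 1 hu)).div
    (hasDerivAt_thetaMoment 0 hu) (thetaMoment_pos 0 hu).ne'
  refine strictAntiOn_of_deriv_neg (convex_Ici 1) (fun u hu ↦ ?_) fun u hu ↦ ?_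
  · exact (hder (lt_of_lt_of_le one_pos hu)).continuousAt.continuousWithinAt
  rw [interior_Ici, mem_Ioi] at hu
  have hu₀ : 0 < u := one_pos.trans hu
  have hd : deriv thetaLogSlope u = _ := (hder hu₀).deriv
  rw [hd]
  refine div_neg_of_neg_of_pos ?_ (pow_pos (thetaMoment_pos 0 hu₀) 2)
  simp only [id, Pi.mul_apply, zero_add, Nat.reduceAdd]
  have h0 := one_le_thetaMoment_zero hu₀
  have h1 := thetaMoment_pos 1 hu₀
  have h12 := thetaMoment_one_le_two hu₀
  have h1' := thetaMoment_one_lt hu.le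
  have hx : 3 < π * u := by nlinarith [pi_gt_three]
  generalize thetaMoment 0 u = A at *
  generalize thetaMoment 1 u = B at *
  generalize thetaMoment 2 u = C at *
  have hC : 0 < C := h1.trans_le h12
  have hBC : B ≤ π * u * C / 3 := by nlinarith
  have hxC : 0 < π * u * C := by positivity
  have e1 : (B - π * u * C) * A ≤ -(2 / 3) * (π * u * C) := by nlinarith
  have e2 : π * u * (B * B) < 2 / 3 * (π * u * C) := by
    have : B * B < 2 / 3 * C := by nlinarith
    nlinarith
  linarith

/-- The logarithm of `theta3` in the exponential coordinate. -/
def logTheta (t : ℝ) : ℝ := log (theta3 (exp t))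

lemma hasDerivAt_logTheta (t : ℝ) : HasDerivAt logTheta (-π * thetaLogSlope (exp t)) t := by
  have h := ((hasDerivAt_thetaMoment 0 (exp_pos t)).comp t (Real.hasDerivAt_exp t)).log
    (thetaMoment_pos 0 (exp_pos t)).ne'
  have hf : logTheta = fun t ↦ log ((thetaMoment 0 ∘ exp) t) :=
    funext fun t ↦ by rw [logTheta, theta3_eq_thetaMoment, Function.comp_apply]
  rw [hf]
  refine h.congr_deriv ?_
  simp only [thetaLogSlope, Function.comp_apply, zero_add]
  ring

lemma theta3_pos {u : ℝ} (hu : 0 < u) : 0 < theta3 u := by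
  rw [theta3_eq_thetaMoment]
  exact thetaMoment_pos 0 hu

lemma logTheta_neg (t : ℝ) : logTheta (-t) = t / 2 + logTheta t := by
  have h := Real.tsum_exp_neg_mul_int_sq (exp_pos (-t))
  have h' : theta3 (exp (-t)) = exp (t / 2) * theta3 (exp t) := by
    have hpow : 1 / exp (-t) ^ (1 / 2 : ℝ) = exp (t / 2) := by
      rw [← exp_mul, one_div, ← exp_neg]
      congr 1
      ring
    have hdiv : -π / exp (-t) = -π * exp t := by rw [exp_neg, div_inv_eq_mul]
    rw [hpow, hdiv] at h
    simpa only [theta3, mul_right_comm (-π)] using h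
  rw [logTheta, h', log_mul (exp_ne_zero _) (theta3_pos (exp_pos t)).ne', log_exp, logTheta]

lemma deriv_logTheta_neg (t : ℝ) : deriv logTheta (-t) = -1 / 2 - deriv logTheta t := by
  have h1 : HasDerivAt (fun t ↦ logTheta (-t)) (-deriv logTheta (-t)) t := by
    refine HasDerivAt.congr_deriv
      ((hasDerivAt_logTheta (-t)).differentiableAt.hasDerivAt.comp t (hasDerivAt_neg t)) ?_
    ring
  have h2 : HasDerivAt (fun t ↦ t / 2 + logTheta t) (1 / 2 + deriv logTheta t) t :=
    ((hasDerivAt_id t).div_const 2).add (hasDerivAt_logTheta t).differentiableAt.hasDerivAt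
  rw [funext logTheta_neg] at h1
  linarith [h1.unique h2]

lemma strictMono_deriv_logTheta : StrictMono (deriv logTheta) := by
  have hpos : StrictMonoOn (deriv logTheta) (Ici 0) := fun s hs t ht hst ↦ by
    rw [(hasDerivAt_logTheta s).deriv, (hasDerivAt_logTheta t).deriv]
    have := strictAntiOn_thetaLogSlope (one_le_exp hs) (one_le_exp ht) (exp_lt_exp.mpr hst)
    nlinarith [pi_pos]
  refine StrictMonoOn.Iic_union_Ici (a := 0) (fun s hs t ht hst ↦ ?_) hpos
  have := hpos (neg_nonneg.mpr (mem_Iic.mp ht) : (0 : ℝ) ≤ -t)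
    (neg_nonneg.mpr (mem_Iic.mp hs) : (0 : ℝ) ≤ -s) (neg_lt_neg hst)
  rw [deriv_logTheta_neg, deriv_logTheta_neg] at this
  linarith

/-- `theta3` is strictly log-convex in the exponential coordinate. -/
theorem strictConvexOn_logTheta : StrictConvexOn ℝ univ logTheta :=
  StrictMono.strictConvexOn_univ_of_deriv
    (continuous_iff_continuousAt.mpr fun t ↦ (hasDerivAt_logTheta t).continuousAt)
    strictMono_deriv_logTheta

lemma theta3_sq_lt_mul {r y : ℝ} (hr : 0 < r) (hy : 0 < y) (hy1 : y ≠ 1) :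
    theta3 r ^ 2 < theta3 (r * y⁻¹) * theta3 (r * y) := by
  have hne : log (r * y⁻¹) ≠ log (r * y) := by
    rw [log_mul hr.ne' (inv_ne_zero hy.ne'), log_mul hr.ne' hy.ne', log_inv]
    have := log_ne_zero_of_pos_of_ne_one hy hy1
    intro h
    apply this
    linarith
  have h := strictConvexOn_logTheta.2 (mem_univ _) (mem_univ _) hne
    (half_pos one_pos) (half_pos one_pos) (add_halves 1)
  have hmid : (1 / 2 : ℝ) • log (r * y⁻¹) + (1 / 2 : ℝ) • log (r * y) = log r := by
    rw [log_mul hr.ne' (inv_ne_zero hy.ne'), log_mul hr.ne' hy.ne', log_inv]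
    simp only [smul_eq_mul]
    ring
  have h1 : 0 < r * y⁻¹ := by positivity
  have h2 : 0 < r * y := by positivity
  rw [hmid, logTheta, logTheta, logTheta, exp_log hr, exp_log h1, exp_log h2] at h
  simp only [smul_eq_mul] at h
  rw [← log_lt_log_iff (pow_pos (theta3_pos hr) 2) (mul_pos (theta3_pos h1) (theta3_pos h2)),
    log_pow, log_mul (theta3_pos h1).ne' (theta3_pos h2).ne']
  push_cast
  linarith

/-- for every `r > 0` the function `y ↦ θ₃(iry⁻¹)θ₃(iry)` on `(0,∞)`
attains its minimum `θ₃(ir)²` exactly at `y = 1`. -/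
theorem theta3_product_min (r : ℝ) (hr : 0 < r) (y : ℝ) (hy : 0 < y) :
    theta3 r ^ 2 ≤ theta3 (r * y⁻¹) * theta3 (r * y) ∧
    (theta3 (r * y⁻¹) * theta3 (r * y) = theta3 r ^ 2 ↔ y = 1) := by
  rcases eq_or_ne y 1 with rfl | hy1
  · simp [sq]
  · have h := theta3_sq_lt_mul hr hy hy1
    exact ⟨h.le, iff_of_false h.ne' hy1⟩

end
end
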